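/- A graph is a proper Helly circular-arc (PHCA) graph if and only if it admits a locally straight orientation. -/

import Mathlib

open Set

noncomputable section

instance : Fact ((0:ℝ) < 1) := ⟨one_pos⟩

/-- A point on the circle (of circumference 1). -/
abbrev Circ : Type := AddCircle (1 : ℝ)

/-- An arc of the circle, described by its beginning point `s` and its ending point `t`
(the arc is traversed clockwise, i.e. in the positive circular direction, from `s` to `t`). -/
structure Arc where
  s : Circ
  t : Circ

/-- The set of points of the open arc: the points strictly between `s` and `t`
in the circular order. -/
def Arc.pts (A : Arc) : Set Circ := {x | sbtw A.s x A.t}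

/-- The length of an arc: the representative in `(0, 1]` of `t - s`. -/
def Arc.length (A : Arc) : ℝ := ((AddCircle.equivIoc (1:ℝ) 0) (A.t - A.s) : ℝ)

/-- A circular-arc (CA) model: a finite family of arcs of the circle such that all
endpoints of the arcs are pairwise distinct (in particular each arc has two distinct
endpoints, hence no arc covers the whole circle). -/
structure CAModel (V : Type) [Fintype V] where
  arc : V → Arc
  endpoints_distinct : Function.Injective
    (fun p : V × Bool => if p.2 then (arc p.1).s else (arc p.1).t)

namespace CAModel

variable {V : Type} [Fintype V]

/-- The arcs of `u` and `v` intersect. -/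
def Inter (M : CAModel V) (u v : V) : Prop := ((M.arc u).pts ∩ (M.arc v).pts).Nonempty

/-- The intersection graph of the model: two distinct arcs are adjacent iff they have
nonempty intersection. -/
def interGraph (M : CAModel V) : SimpleGraph V :=
  SimpleGraph.fromRel fun u v => M.Inter u v

/-- `M` is a model of the graph `G`: the arcs are in correspondence with the vertices of `G`
and two vertices are adjacent iff their arcs are distinct and intersect. -/
def IsModelOf (M : CAModel V) (G : SimpleGraph V) : Prop :=
  ∀ u v, G.Adj u v ↔ u ≠ v ∧ M.Inter u v

/-- Helly model: every subfamily of pairwise intersecting arcs has a common point. -/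
def Helly (M : CAModel V) : Prop :=
  ∀ S : Set V, (∀ u ∈ S, ∀ v ∈ S, M.Inter u v) → ∃ p : Circ, ∀ v ∈ S, p ∈ (M.arc v).pts

/-- Normal model: no two arcs together cover the whole circle. -/
def Normal (M : CAModel V) : Prop :=
  ∀ u v : V, u ≠ v → (M.arc u).pts ∪ (M.arc v).pts ≠ Set.univ

/-- No three arcs together cover the whole circle. -/
def NoThreeCover (M : CAModel V) : Prop :=
  ∀ u v w : V, u ≠ v → u ≠ w → v ≠ w →
    (M.arc u).pts ∪ (M.arc v).pts ∪ (M.arc w).pts ≠ Set.univ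

/-- Proper model: no arc is properly contained in another arc. -/
def Proper (M : CAModel V) : Prop :=
  ∀ u v : V, u ≠ v → ¬ (M.arc u).pts ⊂ (M.arc v).pts

/-- Unit model: all arcs have the same length. -/
def IsUnit (M : CAModel V) : Prop :=
  ∀ u v : V, (M.arc u).length = (M.arc v).length

/-- Interval model: some point of the circle is covered by no arc. -/
def IsIntervalModel (M : CAModel V) : Prop :=
  ∃ p : Circ, ∀ v : V, p ∉ (M.arc v).pts

/-- A universal arc: it intersects every other arc of the model. -/
def UniversalArc (M : CAModel V) (v : V) : Prop :=
  ∀ w, w ≠ v → M.Inter v w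

end CAModel

section GraphClasses

variable {V : Type} [Fintype V]

def IsCAGraph (G : SimpleGraph V) : Prop := ∃ M : CAModel V, M.IsModelOf G
def IsHCAGraph (G : SimpleGraph V) : Prop := ∃ M : CAModel V, M.Helly ∧ M.IsModelOf G
def IsNCAGraph (G : SimpleGraph V) : Prop := ∃ M : CAModel V, M.Normal ∧ M.IsModelOf G
def IsNHCAGraph (G : SimpleGraph V) : Prop :=
  ∃ M : CAModel V, M.Normal ∧ M.Helly ∧ M.IsModelOf G
def IsPCAGraph (G : SimpleGraph V) : Prop := ∃ M : CAModel V, M.Proper ∧ M.IsModelOf G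
def IsNPCAGraph (G : SimpleGraph V) : Prop :=
  ∃ M : CAModel V, M.Normal ∧ M.Proper ∧ M.IsModelOf G
def IsPHCAGraph (G : SimpleGraph V) : Prop :=
  ∃ M : CAModel V, M.Proper ∧ M.Helly ∧ M.IsModelOf G
def IsUCAGraph (G : SimpleGraph V) : Prop := ∃ M : CAModel V, M.IsUnit ∧ M.IsModelOf G
def IsUHCAGraph (G : SimpleGraph V) : Prop :=
  ∃ M : CAModel V, M.IsUnit ∧ M.Helly ∧ M.IsModelOf G
def IsIntervalGraph (G : SimpleGraph V) : Prop :=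
  ∃ M : CAModel V, M.IsIntervalModel ∧ M.IsModelOf G

end GraphClasses
/-! ### GraphOrientations and round / straight enumerations -/

/-- An orientation of a graph `G`: each edge of `G` receives exactly one direction. -/
structure GraphOrientation {V : Type} (G : SimpleGraph V) where
  dir : V → V → Prop
  dir_adj : ∀ u v, dir u v → G.Adj u v
  adj_dir : ∀ u v, G.Adj u v → (dir u v ↔ ¬ dir v u)

namespace GraphOrientation

variable {V : Type} [Fintype V] {G : SimpleGraph V}

/-- The out-degree `d⁺(v)` of a vertex. -/
def outDeg (D : GraphOrientation G) (v : V) : ℕ := {w | D.dir v w}.ncard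

/-- The in-degree `d⁻(v)` of a vertex. -/
def inDeg (D : GraphOrientation G) (v : V) : ℕ := {w | D.dir w v}.ncard

end GraphOrientation

/-- The clockwise (forward) circular distance from position `i` to position `j`
among `n` circular positions. -/
def cdist (n : ℕ) (i j : Fin n) : ℕ := ((j : ℕ) + n - (i : ℕ)) % n

variable {V : Type} [Fintype V] {G : SimpleGraph V}

/-- `σ` is an out-round enumeration of `D`: for every `i`,
`N⁺[v_i] = {v_i, v_{i+1}, …, v_{i+d⁺(v_i)}}`, indices modulo `n`; equivalently,
`v_j ∈ N⁺[v_i]` iff the clockwise distance from `i` to `j` is at most `d⁺(v_i)`. -/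
def IsOutRoundEnum (D : GraphOrientation G) (σ : Fin (Fintype.card V) ≃ V) : Prop :=
  ∀ i j : Fin (Fintype.card V),
    (σ j = σ i ∨ D.dir (σ i) (σ j)) ↔
      cdist (Fintype.card V) i j ≤ D.outDeg (σ i)

/-- `σ` is a round enumeration of `D`: additionally to the out-round condition,
`N⁻[v_i] = {v_{i-d⁻(v_i)}, …, v_i}`, indices modulo `n`. -/
def IsRoundEnum (D : GraphOrientation G) (σ : Fin (Fintype.card V) ≃ V) : Prop :=
  ∀ i j : Fin (Fintype.card V),
    ((σ j = σ i ∨ D.dir (σ i) (σ j)) ↔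
      cdist (Fintype.card V) i j ≤ D.outDeg (σ i)) ∧
    ((σ j = σ i ∨ D.dir (σ j) (σ i)) ↔
      cdist (Fintype.card V) j i ≤ D.inDeg (σ i))

/-- Position `l` holds the leftmost neighbor of `v_i`: `v_l ∈ N⁻[v_i]` and `v_l` is the
member of `N⁻[v_i]` reached last when traversing the enumeration backwards from `v_i`. -/
def IsLeftmostPos (D : GraphOrientation G) (σ : Fin (Fintype.card V) ≃ V)
    (i l : Fin (Fintype.card V)) : Prop :=
  (σ l = σ i ∨ D.dir (σ l) (σ i)) ∧
  ∀ l' : Fin (Fintype.card V), (σ l' = σ i ∨ D.dir (σ l') (σ i)) →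
    cdist (Fintype.card V) l' i ≤ cdist (Fintype.card V) l i

/-- Position `r` holds the rightmost neighbor of `v_i`: `v_r ∈ N⁺[v_i]` and `v_r` is the
member of `N⁺[v_i]` reached last when traversing the enumeration forwards from `v_i`. -/
def IsRightmostPos (D : GraphOrientation G) (σ : Fin (Fintype.card V) ≃ V)
    (i r : Fin (Fintype.card V)) : Prop :=
  (σ r = σ i ∨ D.dir (σ i) (σ r)) ∧
  ∀ r' : Fin (Fintype.card V), (σ r' = σ i ∨ D.dir (σ i) (σ r')) →
    cdist (Fintype.card V) i r' ≤ cdist (Fintype.card V) i r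

/-- The out-degree of `v_j` inside the scope `Cir[v_l, v_r]` (the subdigraph induced by
the positions in the circular range from `l` to `r`). -/
def scopeOutDeg (D : GraphOrientation G) (σ : Fin (Fintype.card V) ≃ V)
    (l r j : Fin (Fintype.card V)) : ℕ :=
  {k : Fin (Fintype.card V) |
    cdist (Fintype.card V) l k ≤ cdist (Fintype.card V) l r ∧ D.dir (σ j) (σ k)}.ncard

/-- The in-degree of `v_j` inside the scope `Cir[v_l, v_r]`. -/
def scopeInDeg (D : GraphOrientation G) (σ : Fin (Fintype.card V) ≃ V)
    (l r j : Fin (Fintype.card V)) : ℕ :=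
  {k : Fin (Fintype.card V) |
    cdist (Fintype.card V) l k ≤ cdist (Fintype.card V) l r ∧ D.dir (σ k) (σ j)}.ncard

/-- `σ` is a locally out-straight enumeration: it is out-round and, for every vertex
`v_i`, its scope `Cir[v_l, v_r]` (where `v_l`, `v_r` are the leftmost and rightmost
neighbors of `v_i`), in the order induced by `σ` (position within the scope being the
clockwise distance from `l`), is an out-straight enumeration of the induced subdigraph:
for `v_j, v_k` in the scope, `v_k ∈ N⁺[v_j]` (within the scope) iff the position of `v_k`
lies in the linear range from the position of `v_j` to the position of `v_j` plus the
out-degree of `v_j` in the subdigraph. -/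
def IsLocallyOutStraightEnum (D : GraphOrientation G) (σ : Fin (Fintype.card V) ≃ V) : Prop :=
  IsOutRoundEnum D σ ∧
  ∀ i l r : Fin (Fintype.card V),
    IsLeftmostPos D σ i l → IsRightmostPos D σ i r →
    ∀ j k : Fin (Fintype.card V),
      cdist (Fintype.card V) l j ≤ cdist (Fintype.card V) l r →
      cdist (Fintype.card V) l k ≤ cdist (Fintype.card V) l r →
      ((σ k = σ j ∨ D.dir (σ j) (σ k)) ↔
        (cdist (Fintype.card V) l j ≤ cdist (Fintype.card V) l k ∧
         cdist (Fintype.card V) l k ≤ cdist (Fintype.card V) l j + scopeOutDeg D σ l r j))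

/-- `σ` is a locally straight enumeration: it is round and, for every vertex `v_i`, its
scope `Cir[v_l, v_r]`, in the order induced by `σ`, is a straight enumeration of the
induced subdigraph: for `v_j, v_k` in the scope, `v_k ∈ N⁺[v_j]` (within the scope) iff
the position of `v_k` lies in the linear range from `v_j` forwards of length the
out-degree of `v_j` in the subdigraph, and `v_k ∈ N⁻[v_j]` (within the scope) iff the
position of `v_k` lies in the linear range ending at `v_j` of length the in-degree of
`v_j` in the subdigraph. -/
def IsLocallyStraightEnum (D : GraphOrientation G) (σ : Fin (Fintype.card V) ≃ V) : Prop :=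
  IsRoundEnum D σ ∧
  ∀ i l r : Fin (Fintype.card V),
    IsLeftmostPos D σ i l → IsRightmostPos D σ i r →
    ∀ j k : Fin (Fintype.card V),
      cdist (Fintype.card V) l j ≤ cdist (Fintype.card V) l r →
      cdist (Fintype.card V) l k ≤ cdist (Fintype.card V) l r →
      (((σ k = σ j ∨ D.dir (σ j) (σ k)) ↔
        (cdist (Fintype.card V) l j ≤ cdist (Fintype.card V) l k ∧
         cdist (Fintype.card V) l k ≤ cdist (Fintype.card V) l j + scopeOutDeg D σ l r j)) ∧
       ((σ k = σ j ∨ D.dir (σ k) (σ j)) ↔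
        (cdist (Fintype.card V) l k ≤ cdist (Fintype.card V) l j ∧
         cdist (Fintype.card V) l j ≤ cdist (Fintype.card V) l k + scopeInDeg D σ l r j)))

/-! ### Circle coordinates -/

/-- Strict cyclic betweenness in a linear order. -/
def SB {α : Type} [LT α] (a x b : α) : Prop := (a < x ∧ x < b) ∨ (x < b ∧ b < a) ∨ (b < a ∧ a < x)

theorem sbtw_coe_fract (a x b : ℝ) :
    sbtw (a : Circ) (x : Circ) (b : Circ) ↔
      0 < Int.fract (x - a) ∧ Int.fract (x - a) < Int.fract (b - a) := by
  have h1 : sbtw (a : Circ) (x : Circ) (b : Circ) ↔ sbtw (x : Circ) (b : Circ) (a : Circ) :=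
    ⟨fun h => h.cyclic_left, fun h => h.cyclic_right⟩
  have h0 : btw (a : Circ) (b : Circ) (x : Circ) ↔ _ :=
    QuotientAddGroup.btw_coe_iff' (p := (1:ℝ)) (x₁ := a) (x₂ := b) (x₃ := x)
  rw [h1, sbtw_iff_not_btw, h0, toIocMod_eq_sub_fract_mul, toIcoMod_eq_fract_mul]
  have e : (0 + 1 - (x - a)) / 1 = -(x - a) + 1 := by ring
  rw [e, Int.fract_add_one]
  simp only [div_one, mul_one, zero_add]
  have hb := Int.fract_lt_one (b - a)
  have hb0 := Int.fract_nonneg (b - a)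
  have hx0 := Int.fract_nonneg (x - a)
  rcases eq_or_ne (Int.fract (x - a)) 0 with h | h
  · rw [Int.fract_neg_eq_zero.mpr h, h]
    constructor
    · intro h; linarith
    · intro h; linarith [h.1]
  · rw [Int.fract_neg h]
    have := lt_of_le_of_ne hx0 (Ne.symm h)
    constructor
    · intro h; constructor <;> linarith
    · intro h; linarith [h.2]

/-- The coordinate of `x` in `[0, 1)` relative to the base point `c`. -/
def co (c x : Circ) : ℝ := ((AddCircle.equivIco (1:ℝ) 0) (x - c) : ℝ)

theorem co_nonneg (c x : Circ) : 0 ≤ co c x := ((AddCircle.equivIco (1:ℝ) 0) (x - c)).2.1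

theorem co_lt_one (c x : Circ) : co c x < 1 := by
  have := ((AddCircle.equivIco (1:ℝ) 0) (x - c)).2.2
  simpa [co] using this

theorem co_coe (c x : Circ) : ((co c x : ℝ) : Circ) = x - c := by
  simp [co]

theorem co_inj {c x y : Circ} : co c x = co c y ↔ x = y := by
  constructor
  · intro h
    have := congrArg (fun r : ℝ => (r : Circ)) h
    simp only [co_coe] at this
    exact sub_left_injective this
  · rintro rfl; rfl

theorem co_self (c : Circ) : co c c = 0 := by
  have : ((AddCircle.equivIco (1:ℝ) 0) ((0:ℝ) : Circ) : ℝ) = 0 :=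
    AddCircle.equivIco_coe_of_mem (by simp)
  simpa [co] using this

theorem co_pos {c x : Circ} (h : x ≠ c) : 0 < co c x := by
  refine lt_of_le_of_ne (co_nonneg c x) ?_
  intro h'
  rw [← co_self c, co_inj] at h'
  exact h h'.symm

theorem co_surj (c : Circ) {r : ℝ} (h0 : 0 ≤ r) (h1 : r < 1) : ∃ x, co c x = r := by
  refine ⟨(r : Circ) + c, ?_⟩
  have : ((AddCircle.equivIco (1:ℝ) 0) ((r:ℝ) : Circ) : ℝ) = r :=
    AddCircle.equivIco_coe_of_mem (by simp [h0, h1])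
  simpa [co] using this

theorem fract_sub_cases {a x : ℝ} (ha : 0 ≤ a) (ha1 : a < 1) (hx : 0 ≤ x) (hx1 : x < 1) :
    (a ≤ x ∧ Int.fract (x - a) = x - a) ∨ (x < a ∧ Int.fract (x - a) = x - a + 1) := by
  rcases le_or_gt a x with h | h
  · left
    refine ⟨h, Int.fract_eq_self.mpr ⟨by linarith, by linarith⟩⟩
  · right
    refine ⟨h, ?_⟩
    rw [← Int.fract_add_one]
    exact Int.fract_eq_self.mpr ⟨by linarith, by linarith⟩

theorem sbtw_add (a x b c : Circ) : sbtw (a + c) (x + c) (b + c) ↔ sbtw a x b := by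
  induction a using QuotientAddGroup.induction_on with | _ a
  induction x using QuotientAddGroup.induction_on with | _ x
  induction b using QuotientAddGroup.induction_on with | _ b
  induction c using QuotientAddGroup.induction_on with | _ c
  have h1 := sbtw_coe_fract a x b
  have h2 := sbtw_coe_fract (a + c) (x + c) (b + c)
  rw [add_sub_add_right_eq_sub, add_sub_add_right_eq_sub, ← h1] at h2
  exact h2

theorem sbtw_co (c a x b : Circ) : sbtw a x b ↔ SB (co c a) (co c x) (co c b) := by
  have h := sbtw_add a x b (-c)
  simp only [← sub_eq_add_neg] at h
  rw [← h, ← co_coe c a, ← co_coe c x, ← co_coe c b, sbtw_coe_fract]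
  unfold SB
  rcases fract_sub_cases (co_nonneg c a) (co_lt_one c a) (co_nonneg c x) (co_lt_one c x) with
    ⟨h1, h2⟩ | ⟨h1, h2⟩ <;>
  rcases fract_sub_cases (co_nonneg c a) (co_lt_one c a) (co_nonneg c b) (co_lt_one c b) with
    ⟨h3, h4⟩ | ⟨h3, h4⟩ <;> rw [h2, h4] <;>
  have ha1 := co_nonneg c a <;> have ha2 := co_lt_one c a <;>
  have hb1 := co_nonneg c b <;> have hb2 := co_lt_one c b <;>
  have hx1 := co_nonneg c x <;> have hx2 := co_lt_one c x <;>
  grind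

/-! ### Circular distance and counting -/

theorem cdist_eq {n : ℕ} (i j : Fin n) :
    cdist n i j = if (i:ℕ) ≤ j then (j:ℕ) - i else (j:ℕ) + n - i := by
  unfold cdist
  have hi := i.2
  have hj := j.2
  split_ifs with h
  · rw [show (j:ℕ) + n - i = (j - i) + n by omega, Nat.add_mod_right, Nat.mod_eq_of_lt (by omega)]
  · rw [Nat.mod_eq_of_lt (by omega)]

theorem cdist_lt {n : ℕ} (i j : Fin n) : cdist n i j < n := by
  have hi := i.2
  have hj := j.2
  rw [cdist_eq]; split_ifs <;> omega

theorem cdist_inj {n : ℕ} (l : Fin n) {j k : Fin n} (h : cdist n l j = cdist n l k) : j = k := by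
  have := j.2
  have := k.2
  have := l.2
  rw [cdist_eq, cdist_eq] at h
  apply Fin.ext
  split_ifs at h <;> omega

theorem cdist_inj' {n : ℕ} (l : Fin n) {j k : Fin n} (h : cdist n j l = cdist n k l) : j = k := by
  have := j.2
  have := k.2
  have := l.2
  rw [cdist_eq, cdist_eq] at h
  apply Fin.ext
  split_ifs at h <;> omega

theorem cdist_surj {n : ℕ} (l : Fin n) {y : ℕ} (h : y < n) : ∃ j, cdist n l j = y := by
  have := l.2
  by_cases h' : (l:ℕ) + y < n
  · refine ⟨⟨l + y, h'⟩, ?_⟩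
    rw [cdist_eq]; simp
  · refine ⟨⟨l + y - n, by omega⟩, ?_⟩
    rw [cdist_eq]; simp only; split_ifs <;> omega

theorem cdist_surj' {n : ℕ} (l : Fin n) {y : ℕ} (h : y < n) : ∃ j, cdist n j l = y := by
  have := l.2
  by_cases h' : y ≤ (l:ℕ)
  · refine ⟨⟨l - y, by omega⟩, ?_⟩
    rw [cdist_eq]; simp only; split_ifs <;> omega
  · refine ⟨⟨l + n - y, by omega⟩, ?_⟩
    rw [cdist_eq]; simp only; split_ifs <;> omega

theorem cdist_self {n : ℕ} (l : Fin n) : cdist n l l = 0 := by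
  rw [cdist_eq]; simp

/-- Cyclic betweenness of positions, measured from any base position. -/
theorem SB_cdist {n : ℕ} (l i k j : Fin n) :
    SB i k j ↔ SB (cdist n l i) (cdist n l k) (cdist n l j) := by
  have := j.2
  have := k.2
  have := l.2
  have := i.2
  unfold SB
  simp only [cdist_eq, Fin.lt_def]
  split_ifs <;> omega

theorem count_up (A : Set ℕ) (hA : A.Finite) (a : ℕ) (h1 : ∀ x ∈ A, a < x)
    (h2 : ∀ x ∈ A, ∀ y, a < y → y ≤ x → y ∈ A) (x : ℕ) :
    x ∈ A ↔ a < x ∧ x ≤ a + A.ncard := by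
  rcases A.eq_empty_or_nonempty with rfl | hne
  · simp
  · obtain ⟨m, hm, hmax⟩ := hA.exists_maximalFor id A hne
    have e : A = ↑(Finset.Ioc a m) := by
      ext y
      simp only [Finset.coe_Ioc, Set.mem_Ioc]
      constructor
      · intro hy
        refine ⟨h1 y hy, ?_⟩
        by_contra hc
        have := hmax hy (by simp; omega)
        simp at this; omega
      · rintro ⟨h3, h4⟩
        exact h2 m hm y h3 h4
    have := h1 m hm
    rw [e, Set.ncard_coe_finset, Nat.card_Ioc]
    simp only [Finset.coe_Ioc, Set.mem_Ioc]
    omega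

theorem count_down (A : Set ℕ) (a : ℕ) (h1 : ∀ x ∈ A, x < a)
    (h2 : ∀ x ∈ A, ∀ y, y < a → x ≤ y → y ∈ A) (x : ℕ) :
    x ∈ A ↔ x < a ∧ a ≤ x + A.ncard := by
  have hf : A.Finite := (Set.finite_Iio a).subset h1
  rcases A.eq_empty_or_nonempty with rfl | hne
  · simp
  · obtain ⟨m, hm, hmin⟩ := hf.exists_minimalFor id A hne
    have e : A = ↑(Finset.Ico m a) := by
      ext y
      simp only [Finset.coe_Ico, Set.mem_Ico]
      constructor
      · intro hy
        refine ⟨?_, h1 y hy⟩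
        by_contra hc
        have := hmin hy (by simp; omega)
        simp at this; omega
      · rintro ⟨h3, h4⟩
        exact h2 m hm y h4 h3
    have := h1 m hm
    rw [e, Set.ncard_coe_finset, Nat.card_Ico]
    simp only [Finset.coe_Ico, Set.mem_Ico]
    omega

/-! ### From a cyclically convex orientation to a locally straight enumeration -/

theorem locallyStraight_of {V : Type} [Fintype V] {G : SimpleGraph V} (D : GraphOrientation G)
    (σ : Fin (Fintype.card V) ≃ V)
    (h1 : ∀ i j k, D.dir (σ i) (σ j) → SB i k j → D.dir (σ i) (σ k) ∧ D.dir (σ k) (σ j))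
    (h2 : ∀ i j k, D.dir i j → D.dir j k → D.dir k i → False) :
    IsLocallyStraightEnum D σ := by
  have hirr : ∀ v, ¬ D.dir v v := fun v h => (D.dir_adj _ _ h).ne rfl
  have hanti : ∀ u v, D.dir u v → D.dir v u → False := fun u v h h' =>
    (D.adj_dir u v (D.dir_adj _ _ h)).1 h h'
  have hne : ∀ i j, D.dir (σ i) (σ j) → i ≠ j := by
    rintro i j h rfl; exact hirr _ h
  have c0 : ∀ i j, i ≠ j → 0 < cdist (Fintype.card V) i j := by
    intro i j hij
    rcases Nat.eq_zero_or_pos (cdist (Fintype.card V) i j) with h | h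
    · exact absurd (cdist_inj i ((cdist_self i).trans h.symm)) hij
    · exact h
  constructor
  · intro i j
    constructor
    · have key := count_up ((fun j => cdist (Fintype.card V) i j) '' {j | D.dir (σ i) (σ j)})
        (Set.toFinite _) 0
        (by rintro _ ⟨j, hj, rfl⟩; exact c0 _ _ (hne _ _ hj))
        (by
          rintro _ ⟨j, hj, rfl⟩ y hy hyx
          simp only at hyx
          obtain ⟨k, rfl⟩ := cdist_surj i (lt_of_le_of_lt hyx (cdist_lt i j))
          refine ⟨k, ?_, rfl⟩
          rcases eq_or_lt_of_le hyx with h | h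
          · rw [cdist_inj i h]; exact hj
          · refine (h1 i j k hj ?_).1
            rw [SB_cdist i, cdist_self]; left; exact ⟨hy, h⟩) (cdist (Fintype.card V) i j)
      rw [Set.ncard_image_of_injective _ (fun a b h => cdist_inj i h)] at key
      have e : {j | D.dir (σ i) (σ j)}.ncard = D.outDeg (σ i) := by
        unfold GraphOrientation.outDeg
        rw [← Set.ncard_image_of_injective _ σ.injective]
        congr 1
        ext w
        simp only [Set.mem_image, Set.mem_ofPred_eq]
        constructor
        · rintro ⟨x, hx, rfl⟩; exact hx
        · intro h; exact ⟨σ.symm w, by simpa using h, by simp⟩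
      rw [e] at key
      by_cases hij : j = i
      · subst hij; simp [cdist_self]
      · have e2 : σ j ≠ σ i := fun h => hij (σ.injective h)
        have := c0 i j (Ne.symm hij)
        simp only [e2, false_or]
        constructor
        · intro h; have := (key.1 ⟨j, h, rfl⟩).2; omega
        · intro h
          obtain ⟨j', hj', e⟩ := key.2 ⟨this, by omega⟩
          rw [← cdist_inj i e]; exact hj'
    · have key := count_up ((fun j => cdist (Fintype.card V) j i) '' {j | D.dir (σ j) (σ i)})
        (Set.toFinite _) 0
        (by rintro _ ⟨j, hj, rfl⟩; exact c0 _ _ (hne _ _ hj))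
        (by
          rintro _ ⟨j, hj, rfl⟩ y hy hyx
          simp only at hyx
          obtain ⟨k, rfl⟩ := cdist_surj' i (lt_of_le_of_lt hyx (cdist_lt j i))
          refine ⟨k, ?_, rfl⟩
          rcases eq_or_lt_of_le hyx with h | h
          · rw [cdist_inj' i h]; exact hj
          · refine (h1 j i k hj ?_).2
            have := i.2
            have := j.2
            have := k.2
            simp only [SB, Fin.lt_def]
            rw [cdist_eq] at h hy
            rw [cdist_eq] at h
            split_ifs at h hy <;> omega) (cdist (Fintype.card V) j i)
      rw [Set.ncard_image_of_injective _ (fun a b h => cdist_inj' i h)] at key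
      have e : {j | D.dir (σ j) (σ i)}.ncard = D.inDeg (σ i) := by
        unfold GraphOrientation.inDeg
        rw [← Set.ncard_image_of_injective _ σ.injective]
        congr 1
        ext w
        simp only [Set.mem_image, Set.mem_ofPred_eq]
        constructor
        · rintro ⟨x, hx, rfl⟩; exact hx
        · intro h; exact ⟨σ.symm w, by simpa using h, by simp⟩
      rw [e] at key
      by_cases hij : j = i
      · subst hij; simp [cdist_self]
      · have e2 : σ j ≠ σ i := fun h => hij (σ.injective h)
        have := c0 j i hij
        simp only [e2, false_or]
        constructor
        · intro h; have := (key.1 ⟨j, h, rfl⟩).2; omega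
        · intro h
          obtain ⟨j', hj', e⟩ := key.2 ⟨this, by omega⟩
          rw [← cdist_inj' i e]; exact hj'
  · intro i l r hl hr
    -- positions relative to `l`
    obtain ⟨p, hp⟩ : ∃ p : Fin (Fintype.card V) → ℕ, p = cdist (Fintype.card V) l := ⟨_, rfl⟩
    have pinj : ∀ {j k}, p j = p k → j = k := by
      intro j k h; rw [hp] at h; exact cdist_inj l h
    have psurj : ∀ y, y < Fintype.card V → ∃ j, p j = y := by
      intro y h; rw [hp]; exact cdist_surj l h
    have plt : ∀ j, p j < Fintype.card V := by intro j; rw [hp]; exact cdist_lt l j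
    have pl : p l = 0 := by rw [hp]; exact cdist_self l
    have pSB : ∀ i k j, SB i k j ↔ SB (p i) (p k) (p j) := by
      intro i k j; rw [hp]; exact SB_cdist l i k j
    have hl' : l = i ∨ D.dir (σ l) (σ i) := by
      rcases hl.1 with h | h
      · exact Or.inl (σ.injective h)
      · exact Or.inr h
    have hr' : r = i ∨ D.dir (σ i) (σ r) := by
      rcases hr.1 with h | h
      · exact Or.inl (σ.injective h)
      · exact Or.inr h
    have hir : p i ≤ p r := by
      rcases hl' with rfl | hl'
      · omega
      rcases hr' with rfl | hr'
      · omega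
      by_contra hc
      by_cases hlr : l = r
      · subst hlr; exact hanti _ _ hl' hr'
      have : p r ≠ p l := fun h => hlr (pinj h).symm
      have := h1 l i r hl' ((pSB _ _ _).2 (by unfold SB; omega))
      exact hanti _ _ this.2 hr'
    have toi : ∀ k, p k < p i → D.dir (σ k) (σ i) := by
      intro k hk
      rcases hl' with rfl | hl'
      · omega
      by_cases hkl : k = l
      · rw [hkl]; exact hl'
      have : p k ≠ p l := fun h => hkl (pinj h)
      exact (h1 l i k hl' ((pSB _ _ _).2 (by unfold SB; omega))).2
    have fromi : ∀ k, p i < p k → p k ≤ p r → D.dir (σ i) (σ k) := by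
      intro k hk hk2
      rcases hr' with rfl | hr'
      · omega
      by_cases hkl : k = r
      · rw [hkl]; exact hr'
      have : p k ≠ p r := fun h => hkl (pinj h)
      exact (h1 i r k hr' ((pSB _ _ _).2 (by unfold SB; omega))).1
    have nowrap : ∀ j k, p j ≤ p r → p k ≤ p r → D.dir (σ j) (σ k) → p j < p k := by
      intro j k hj hk hd
      by_contra hc
      have hjk : p j ≠ p k := fun h => hne _ _ hd (pinj h)
      rcases lt_trichotomy (p k) (p i) with h | h | h
      · rcases lt_trichotomy (p i) (p j) with h' | h' | h'
        · exact h2 _ _ _ (toi k h) (fromi j h' hj) hd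
        · rw [pinj h'] at toi; exact hanti _ _ (toi k (by omega)) hd
        · have := h1 j k i hd ((pSB _ _ _).2 (by unfold SB; omega))
          exact hanti _ _ (toi k h) this.2
      · rw [← pinj h] at fromi
        exact hanti _ _ (fromi j (by omega) hj) hd
      · have := h1 j k i hd ((pSB _ _ _).2 (by unfold SB; omega))
        exact hanti _ _ (fromi j (by omega) hj) this.1
    intro j k hj hk
    rw [← hp] at hj hk ⊢
    constructor
    · have key := count_up (p '' {k | p k ≤ p r ∧ D.dir (σ j) (σ k)}) (Set.toFinite _) (p j)
        (by rintro _ ⟨k, hk, rfl⟩; exact nowrap _ _ hj hk.1 hk.2)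
        (by
          rintro _ ⟨k, hk, rfl⟩ y hy hyx
          obtain ⟨m, rfl⟩ := psurj y (lt_of_le_of_lt hyx (plt k))
          refine ⟨m, ⟨by have := hk.1; omega, ?_⟩, rfl⟩
          rcases eq_or_lt_of_le hyx with h | h
          · rw [pinj h]; exact hk.2
          · exact (h1 j k m hk.2 ((pSB _ _ _).2 (by unfold SB; omega))).1) (p k)
      rw [Set.ncard_image_of_injective _ (fun a b h => pinj h)] at key
      have e : {k | p k ≤ p r ∧ D.dir (σ j) (σ k)}.ncard = scopeOutDeg D σ l r j := by
        rw [hp]; rfl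
      rw [e] at key
      by_cases hkj : k = j
      · subst hkj; simp
      have e2 : σ k ≠ σ j := fun h => hkj (σ.injective h)
      have e3 : p k ≠ p j := fun h => hkj (pinj h)
      simp only [e2, false_or]
      constructor
      · intro h; have := (key.1 ⟨k, ⟨hk, h⟩, rfl⟩); omega
      · intro h
        obtain ⟨k', hk', e⟩ := key.2 (by omega)
        rw [← pinj e]; exact hk'.2
    · have key := count_down (p '' {k | p k ≤ p r ∧ D.dir (σ k) (σ j)}) (p j)
        (by rintro _ ⟨k, hk, rfl⟩; exact nowrap _ _ hk.1 hj hk.2)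
        (by
          rintro _ ⟨k, hk, rfl⟩ y hy hyx
          obtain ⟨m, rfl⟩ := psurj y (lt_trans hy (plt j))
          refine ⟨m, ⟨by omega, ?_⟩, rfl⟩
          rcases eq_or_lt_of_le hyx with h | h
          · rw [← pinj h]; exact hk.2
          · exact (h1 k j m hk.2 ((pSB _ _ _).2 (by unfold SB; omega))).2) (p k)
      rw [Set.ncard_image_of_injective _ (fun a b h => pinj h)] at key
      have e : {k | p k ≤ p r ∧ D.dir (σ k) (σ j)}.ncard = scopeInDeg D σ l r j := by
        rw [hp]; rfl
      rw [e] at key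
      by_cases hkj : k = j
      · subst hkj; simp
      have e2 : σ k ≠ σ j := fun h => hkj (σ.injective h)
      have e3 : p k ≠ p j := fun h => hkj (pinj h)
      simp only [e2, false_or]
      constructor
      · intro h; have := (key.1 ⟨k, ⟨hk, h⟩, rfl⟩); omega
      · intro h
        obtain ⟨k', hk', e⟩ := key.2 (by omega)
        rw [← pinj e]; exact hk'.2

/-! ### From a proper Helly model to a locally straight orientation -/

theorem mem_pts {A : Arc} {x : Circ} : x ∈ A.pts ↔ sbtw A.s x A.t := Iff.rfl

namespace CAModel

variable {V : Type} [Fintype V] (M : CAModel V)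

/-- The beginning point of `v` lies in the arc of `u`. -/
def Hits (u v : V) : Prop := sbtw (M.arc u).s (M.arc v).s (M.arc u).t

theorem s_ne {u v : V} (h : u ≠ v) : (M.arc u).s ≠ (M.arc v).s := by
  intro e
  have := @M.endpoints_distinct (u, true) (v, true) (by simpa using e)
  exact h (by simpa using this)

theorem t_ne {u v : V} (h : u ≠ v) : (M.arc u).t ≠ (M.arc v).t := by
  intro e
  have := @M.endpoints_distinct (u, false) (v, false) (by simpa using e)
  exact h (by simpa using this)

theorem t_ne_s (u v : V) : (M.arc u).t ≠ (M.arc v).s := by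
  intro e
  have := @M.endpoints_distinct (u, false) (v, true) (by simpa using e)
  simp at this

theorem not_hits_self (u : V) : ¬ M.Hits u u := sbtw_irrefl_left

theorem inter_symm {u v : V} (h : M.Inter u v) : M.Inter v u := by
  unfold Inter at *; rwa [Set.inter_comm]

theorem inter_of_hits {u v : V} (h : M.Hits u v) : M.Inter u v := by
  have huv : v ≠ u := by rintro rfl; exact M.not_hits_self _ h
  unfold Hits at h
  rw [sbtw_co (M.arc u).s, co_self] at h
  have hS := co_pos (M.s_ne huv)
  have hT := co_pos (M.t_ne_s u u)
  have hT' := co_pos (M.t_ne_s v u)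
  have hT1 := co_lt_one (M.arc u).s (M.arc u).t
  have hne : co (M.arc u).s (M.arc v).t ≠ co (M.arc u).s (M.arc v).s :=
    fun e => M.t_ne_s v v (co_inj.1 e)
  have : ∃ r : ℝ, 0 ≤ r ∧ r < 1 ∧ SB 0 r (co (M.arc u).s (M.arc u).t) ∧
      SB (co (M.arc u).s (M.arc v).s) r (co (M.arc u).s (M.arc v).t) := by
    generalize co (M.arc u).s (M.arc v).s = S' at *
    generalize co (M.arc u).s (M.arc u).t = T at *
    generalize co (M.arc u).s (M.arc v).t = T' at *
    unfold SB at *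
    have hST : S' < T := by
      rcases h with h | h | h <;> linarith [h.1, h.2]
    rcases lt_or_gt_of_ne hne with h' | h'
    · refine ⟨(S' + T) / 2, by linarith, by linarith, Or.inl ⟨by linarith, by linarith⟩,
        Or.inr (Or.inr ⟨h', by linarith⟩)⟩
    · rcases le_total T T' with h3 | h3
      · refine ⟨(S' + T) / 2, by linarith, by linarith, Or.inl ⟨by linarith, by linarith⟩,
          Or.inl ⟨by linarith, by linarith⟩⟩
      · refine ⟨(S' + T') / 2, by linarith, by linarith, Or.inl ⟨by linarith, by linarith⟩,
          Or.inl ⟨by linarith, by linarith⟩⟩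
  obtain ⟨r, h0, h1, h2, h3⟩ := this
  obtain ⟨x, rfl⟩ := co_surj (M.arc u).s h0 h1
  refine ⟨x, ?_, ?_⟩
  · rw [mem_pts]
    rw [sbtw_co (M.arc u).s, co_self]; exact h2
  · rw [mem_pts]
    rw [sbtw_co (M.arc u).s]; exact h3

theorem hits_of_inter {u v : V} (huv : v ≠ u) (h : M.Inter u v) : M.Hits u v ∨ M.Hits v u := by
  obtain ⟨x, hx, hx'⟩ := h
  rw [mem_pts] at hx hx'
  unfold Hits
  rw [sbtw_co (M.arc u).s] at hx hx' ⊢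
  rw [sbtw_co (M.arc u).s (M.arc v).s]
  rw [co_self] at *
  have hS := co_pos (M.s_ne huv)
  have hT := co_pos (M.t_ne_s u u)
  have hT' := co_pos (M.t_ne_s v u)
  have hx0 := co_nonneg (M.arc u).s x
  generalize co (M.arc u).s (M.arc v).s = S' at *
  generalize co (M.arc u).s (M.arc u).t = T at *
  generalize co (M.arc u).s (M.arc v).t = T' at *
  generalize co (M.arc u).s x = x at *
  unfold SB at *
  grind

theorem inter_self (u : V) : M.Inter u u := by
  have hT := co_pos (M.t_ne_s u u)
  have hT1 := co_lt_one (M.arc u).s (M.arc u).t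
  obtain ⟨x, hx⟩ := co_surj (M.arc u).s
    (show 0 ≤ co (M.arc u).s (M.arc u).t / 2 by linarith) (by linarith)
  refine ⟨x, ?_⟩
  rw [Set.inter_self]
  rw [mem_pts]
  rw [sbtw_co (M.arc u).s, co_self, hx]
  left; constructor <;> linarith

/-- Containment criterion in coordinates. -/
theorem proper_false (hP : M.Proper) (c : Circ) {u v : V} (huv : u ≠ v)
    (h : ∀ x : ℝ, 0 ≤ x → SB (co c (M.arc u).s) x (co c (M.arc u).t) →
      SB (co c (M.arc v).s) x (co c (M.arc v).t)) : False := by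
  have hsub : (M.arc u).pts ⊆ (M.arc v).pts := by
    intro x hx
    rw [mem_pts]
    rw [sbtw_co c]
    apply h _ (co_nonneg _ _)
    rw [← sbtw_co c]; exact mem_pts.1 hx
  refine hP u v huv (lt_of_le_of_ne hsub ?_)
  intro e
  -- equal arcs with distinct endpoints are impossible: use the interior endpoint
  have h1 : ¬ M.Hits u v := by
    intro hh
    have : (M.arc v).s ∈ (M.arc u).pts := mem_pts.2 hh
    rw [e] at this
    exact M.not_hits_self v (mem_pts.1 this)
  have h2 : ¬ M.Hits v u := by
    intro hh
    have : (M.arc u).s ∈ (M.arc v).pts := mem_pts.2 hh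
    rw [← e] at this
    exact M.not_hits_self u (mem_pts.1 this)
  have : M.Inter u v := by
    have := M.inter_self u
    unfold Inter at this ⊢
    rw [← e]; exact this
  rcases M.hits_of_inter huv.symm this with h | h
  · exact h1 h
  · exact h2 h

/-- The convexity of the orientation coming from a proper model. -/
theorem hits_convex (hP : M.Proper) {u w v : V} (h : M.Hits u v)
    (hw : sbtw (M.arc u).s (M.arc w).s (M.arc v).s) : M.Hits u w ∧ M.Hits w v := by
  have hwu : w ≠ u := by rintro rfl; exact sbtw_irrefl_left hw
  have hwv : w ≠ v := by rintro rfl; exact sbtw_irrefl_right hw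
  have hvu : v ≠ u := by rintro rfl; exact sbtw_irrefl_left_right hw
  refine ⟨sbtw_trans_right hw h, ?_⟩
  by_contra hc
  apply M.proper_false hP (M.arc u).s hwu
  unfold Hits at h hc
  rw [sbtw_co (M.arc u).s] at h hc hw
  rw [co_self] at *
  have hS := co_pos (M.s_ne hwu)
  have hS' := co_pos (M.s_ne hvu)
  have hT := co_pos (M.t_ne_s u u)
  have hT' := co_pos (M.t_ne_s w u)
  have hTT : co (M.arc u).s (M.arc w).t ≠ co (M.arc u).s (M.arc v).s :=
    fun e => M.t_ne_s w v (co_inj.1 e)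
  generalize co (M.arc u).s (M.arc v).s = Sv at *
  generalize co (M.arc u).s (M.arc w).s = Sw at *
  generalize co (M.arc u).s (M.arc u).t = T at *
  generalize co (M.arc u).s (M.arc w).t = T' at *
  intro x hx0 hx
  unfold SB at *
  grind

theorem no_triangle (hH : M.Helly) (hN : ∀ u v, M.Hits u v → ¬ M.Hits v u)
    {u v w : V} (h1 : M.Hits u v) (h2 : M.Hits v w) (h3 : M.Hits w u) : False := by
  have i1 := M.inter_of_hits h1
  have i2 := M.inter_of_hits h2
  have i3 := M.inter_of_hits h3
  obtain ⟨q, hq⟩ := hH {u, v, w} (by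
    intro a ha b hb
    simp only [Set.mem_insert_iff, Set.mem_singleton_iff] at ha hb
    rcases ha with rfl | rfl | rfl <;> rcases hb with rfl | rfl | rfl <;>
      first | exact M.inter_self _ | assumption | (apply M.inter_symm; assumption))
  have key : ∀ a b, sbtw (M.arc a).s q (M.arc a).t → sbtw (M.arc b).s q (M.arc b).t →
      M.Hits a b → co q (M.arc a).s < co q (M.arc b).s := by
    intro a b ha hb hab
    have hba := hN _ _ hab
    have hne : co q (M.arc a).s ≠ co q (M.arc b).s := by
      intro e
      have := co_inj.1 e
      unfold Hits at hab
      rw [this] at hab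
      exact sbtw_irrefl_left hab
    unfold Hits at hab hba
    rw [sbtw_co q] at ha hb hab hba
    rw [co_self] at *
    have := co_nonneg q (M.arc a).s
    have := co_nonneg q (M.arc b).s
    have := co_nonneg q (M.arc a).t
    have := co_nonneg q (M.arc b).t
    unfold SB at *
    grind
  have hu := mem_pts.1 (hq u (by simp))
  have hv := mem_pts.1 (hq v (by simp))
  have hw := mem_pts.1 (hq w (by simp))
  have := key _ _ hu hv h1
  have := key _ _ hv hw h2
  have := key _ _ hw hu h3
  linarith

/-- If the arcs of `u` and `v` cover the circle then `u` is universal. -/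
theorem universal_of_cover (hP : M.Proper) {u v : V} (h1 : M.Hits u v) (h2 : M.Hits v u)
    (w : V) : M.Inter u w := by
  by_cases hwu : w = u
  · subst hwu; exact M.inter_self _
  by_cases hwv : w = v
  · subst hwv; exact M.inter_of_hits h1
  by_contra hc
  have c1 : ¬ M.Hits u w := fun h => hc (M.inter_of_hits h)
  have c2 : ¬ M.Hits w u := fun h => hc (M.inter_symm (M.inter_of_hits h))
  have hvu : v ≠ u := by rintro rfl; exact M.not_hits_self _ h1
  apply M.proper_false hP (M.arc u).s hwv
  unfold Hits at *
  rw [sbtw_co (M.arc u).s] at h1 h2 c1 c2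
  rw [co_self] at *
  have := co_pos (M.s_ne hwu)
  have := co_pos (M.s_ne hvu)
  have := co_pos (M.t_ne_s u u)
  have := co_pos (M.t_ne_s w u)
  have := co_pos (M.t_ne_s v u)
  have : co (M.arc u).s (M.arc u).t ≠ co (M.arc u).s (M.arc w).s :=
    fun e => M.t_ne_s u w (co_inj.1 e)
  have : co (M.arc u).s (M.arc w).t ≠ co (M.arc u).s (M.arc w).s :=
    fun e => M.t_ne_s w w (co_inj.1 e)
  generalize co (M.arc u).s (M.arc v).s = Sv at *
  generalize co (M.arc u).s (M.arc w).s = Sw at *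
  generalize co (M.arc u).s (M.arc u).t = T at *
  generalize co (M.arc u).s (M.arc w).t = Tw at *
  generalize co (M.arc u).s (M.arc v).t = Tv at *
  intro x hx0 hx
  unfold SB at *
  grind

/-- In a proper Helly model with two arcs covering the circle, the graph consists of universal
vertices together with two cliques without edges between them. -/
theorem exists_rank (hP : M.Proper) (hH : M.Helly) {u v : V} (h1 : M.Hits u v)
    (h2 : M.Hits v u) : ∃ r : V → ℕ, (∀ x, r x ≤ 2) ∧ ∀ x y,
      M.Inter x y ↔ ¬ (r x = 0 ∧ r y = 2) ∧ ¬ (r x = 2 ∧ r y = 0) := by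
  classical
  have hvu : v ≠ u := by rintro rfl; exact M.not_hits_self _ h1
  obtain ⟨g, hg⟩ : ∃ g : Circ → ℝ, g = co (M.arc u).s := ⟨_, rfl⟩
  have gsb : ∀ a x b, sbtw a x b ↔ SB (g a) (g x) (g b) := by rw [hg]; exact sbtw_co _
  have g0 : g (M.arc u).s = 0 := by rw [hg]; exact co_self _
  have gn : ∀ x, 0 ≤ g x := by rw [hg]; exact co_nonneg _
  have gpos : ∀ x, x ≠ (M.arc u).s → 0 < g x := by rw [hg]; exact fun x h => co_pos h
  have ginj : ∀ {x y}, x ≠ y → g x ≠ g y := by rw [hg]; exact fun h e => h (co_inj.1 e)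
  have hd1 := h1
  have hd2 := h2
  unfold Hits at hd1 hd2
  rw [gsb, g0] at hd1 hd2
  have pSv := gpos _ (M.s_ne hvu)
  have pTu := gpos _ (M.t_ne_s u u)
  have pTv := gpos _ (M.t_ne_s v u)
  have o1 : g (M.arc v).t < g (M.arc v).s := by unfold SB at hd1 hd2; grind
  have o2 : g (M.arc v).s < g (M.arc u).t := by unfold SB at hd1 hd2; grind
  have univ_u : ∀ w, M.Inter u w := M.universal_of_cover hP h1 h2
  have univ_v : ∀ w, M.Inter v w := M.universal_of_cover hP h2 h1
  -- the two types of non-universal arcs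
  have types : ∀ w, (∀ x, M.Inter w x) ∨
      (g (M.arc v).t < g (M.arc w).s ∧ g (M.arc w).s < g (M.arc v).s ∧
        g (M.arc u).t < g (M.arc w).t) ∨
      (g (M.arc v).t < g (M.arc w).t ∧ g (M.arc w).t < g (M.arc v).s ∧
        g (M.arc u).t < g (M.arc w).s) := by
    intro w
    by_cases hw : ∀ x, M.Inter w x
    · exact Or.inl hw
    right
    have hwu : w ≠ u := by rintro rfl; exact hw univ_u
    have hwv : w ≠ v := by rintro rfl; exact hw univ_v
    have n1 : ¬ (M.Hits w u ∧ M.Hits u w) := fun h => hw (M.universal_of_cover hP h.1 h.2)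
    have n2 : ¬ (M.Hits w v ∧ M.Hits v w) := fun h => hw (M.universal_of_cover hP h.1 h.2)
    have i1 := M.hits_of_inter hwu (univ_u w)
    have i2 := M.hits_of_inter hwv (univ_v w)
    have p1 := M.proper_false hP (M.arc u).s hwu
    have p2 := M.proper_false hP (M.arc u).s hwv
    have p3 := M.proper_false hP (M.arc u).s hwu.symm
    have p4 := M.proper_false hP (M.arc u).s hwv.symm
    unfold Hits at n1 n2 i1 i2
    rw [← hg] at p1 p2 p3 p4
    simp only [gsb, g0] at n1 n2 i1 i2 p1 p2 p3 p4
    have pSw := gpos _ (M.s_ne hwu)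
    have pTw := gpos _ (M.t_ne_s w u)
    have e1 := ginj (M.t_ne_s w w)
    have e2 := ginj (M.t_ne_s u w)
    have e3 := ginj (M.t_ne_s v w)
    have e4 := ginj (M.t_ne_s w v)
    have e5 := ginj (M.s_ne hwv)
    have e6 := ginj (M.t_ne hwu)
    have e7 := ginj (M.t_ne hwv)
    generalize g (M.arc v).s = Sv at *
    generalize g (M.arc w).s = Sw at *
    generalize g (M.arc u).t = Tu at *
    generalize g (M.arc w).t = Tw at *
    generalize g (M.arc v).t = Tv at *
    clear univ_u univ_v h1 h2 gsb g0 gn gpos ginj hg hw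
    rcases lt_or_gt_of_ne e2 with a | a
    · -- Tu < Sw
      right
      have b : Tw < Sw := by
        by_contra hc
        unfold SB at i1
        grind
      have c1 : Tw < Tu := by
        by_contra hc
        apply p3
        intro x hx0 hx
        unfold SB at *
        grind
      have c2 : Tv < Tw := by
        by_contra hc
        apply p2
        intro x hx0 hx
        unfold SB at *
        grind
      refine ⟨c2, ?_, a⟩
      unfold SB at n2
      grind
    · left
      have b : Sw < Tw := by
        unfold SB at n1
        grind
      have c1 : Tu < Tw := by
        by_contra hc
        apply p1
        intro x hx0 hx
        unfold SB at *
        grind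
      have c2 : Sw < Sv := by
        by_contra hc
        apply p2
        intro x hx0 hx
        unfold SB at *
        grind
      refine ⟨?_, c2, c1⟩
      unfold SB at n2
      grind
  have aa : ∀ w x, g (M.arc w).s < g (M.arc v).s → g (M.arc u).t < g (M.arc w).t →
      g (M.arc x).s < g (M.arc v).s → g (M.arc u).t < g (M.arc x).t → M.Inter w x := by
    intro w x hw hw' hx hx'
    by_cases e : w = x
    · subst e; exact M.inter_self _
    rcases lt_or_gt_of_ne (ginj (M.s_ne e)) with h | h
    · apply M.inter_of_hits
      unfold Hits; rw [gsb]; left; constructor <;> linarith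
    · apply M.inter_symm
      apply M.inter_of_hits
      unfold Hits; rw [gsb]; left; constructor <;> linarith
  have bb : ∀ w x, g (M.arc w).t < g (M.arc v).s → g (M.arc u).t < g (M.arc w).s →
      g (M.arc x).t < g (M.arc v).s → g (M.arc u).t < g (M.arc x).s → M.Inter w x := by
    intro w x hw hw' hx hx'
    by_cases e : w = x
    · subst e; exact M.inter_self _
    rcases lt_or_gt_of_ne (ginj (M.s_ne e)) with h | h
    · apply M.inter_of_hits
      unfold Hits; rw [gsb]; right; right; constructor <;> linarith
    · apply M.inter_symm
      apply M.inter_of_hits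
      unfold Hits; rw [gsb]; right; right; constructor <;> linarith
  have ab : ∀ w x, (g (M.arc v).t < g (M.arc w).s ∧ g (M.arc w).s < g (M.arc v).s ∧
        g (M.arc u).t < g (M.arc w).t) →
      (g (M.arc v).t < g (M.arc x).t ∧ g (M.arc x).t < g (M.arc v).s ∧
        g (M.arc u).t < g (M.arc x).s) → ¬ M.Inter w x := by
    intro w x hw hx hi
    obtain ⟨q, hq⟩ := hH {u, v, w, x} (by
      intro a ha b hb
      simp only [Set.mem_insert_iff, Set.mem_singleton_iff] at ha hb
      rcases ha with rfl | rfl | rfl | rfl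
      · exact univ_u _
      · exact univ_v _
      · rcases hb with rfl | rfl | rfl | rfl
        · exact M.inter_symm (univ_u _)
        · exact M.inter_symm (univ_v _)
        · exact M.inter_self _
        · exact hi
      · rcases hb with rfl | rfl | rfl | rfl
        · exact M.inter_symm (univ_u _)
        · exact M.inter_symm (univ_v _)
        · exact M.inter_symm hi
        · exact M.inter_self _)
    have q1 := mem_pts.1 (hq u (by simp))
    have q2 := mem_pts.1 (hq v (by simp))
    have q3 := mem_pts.1 (hq w (by simp))
    have q4 := mem_pts.1 (hq x (by simp))
    rw [gsb] at q1 q2 q3 q4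
    rw [g0] at q1
    unfold SB at q1 q2 q3 q4
    clear univ_u univ_v h1 h2 gsb g0 gpos ginj hg hq types aa bb
    have := gn q
    grind
  refine ⟨fun w => if ∀ x, M.Inter w x then 1 else
    if g (M.arc u).t < g (M.arc w).s then 0 else 2, ?_, ?_⟩
  · intro x; dsimp only; split_ifs <;> omega
  intro x y
  by_cases hx : ∀ z, M.Inter x z
  · have := hx y
    simp [hx]
  by_cases hy : ∀ z, M.Inter y z
  · have := M.inter_symm (hy x)
    simp [hy, this]
  have tx := (types x).resolve_left hx
  have ty := (types y).resolve_left hy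
  simp only [hx, hy, if_false]
  rcases tx with tx | tx <;> rcases ty with ty | ty
  · have := aa x y tx.2.1 tx.2.2 ty.2.1 ty.2.2
    have a1 : ¬ g (M.arc u).t < g (M.arc x).s := by linarith [tx.2.1]
    have a2 : ¬ g (M.arc u).t < g (M.arc y).s := by linarith [ty.2.1]
    simp [this, a1, a2]
  · have := ab x y tx ty
    have a1 : ¬ g (M.arc u).t < g (M.arc x).s := by linarith [tx.2.1]
    simp [this, a1, ty.2.2]
  · have : ¬ M.Inter x y := fun h => ab y x ty tx (M.inter_symm h)
    have a1 : ¬ g (M.arc u).t < g (M.arc y).s := by linarith [ty.2.1]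
    simp [this, a1, tx.2.2]
  · have := bb x y tx.2.1 tx.2.2 ty.2.1 ty.2.2
    simp [this, tx.2.2, ty.2.2]

end CAModel

theorem exists_sorted {V : Type} [Fintype V] {α : Type} [LinearOrder α] (f : V → α) :
    ∃ σ : Fin (Fintype.card V) ≃ V, Monotone (f ∘ σ) := by
  let e := (Fintype.equivFin V).symm
  refine ⟨(Tuple.sort (f ∘ e)).trans e, ?_⟩
  exact Tuple.monotone_sort (f ∘ e)

theorem forward {V : Type} [Fintype V] (G : SimpleGraph V) (h : IsPHCAGraph G) :
    ∃ (D : GraphOrientation G) (σ : Fin (Fintype.card V) ≃ V), IsLocallyStraightEnum D σ := by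
  obtain ⟨M, hP, hH, hM⟩ := h
  by_cases hN : ∀ u v, M.Hits u v → ¬ M.Hits v u
  · let D : GraphOrientation G :=
      { dir := M.Hits
        dir_adj := by
          intro u v h
          rw [hM]
          refine ⟨?_, M.inter_of_hits h⟩
          rintro rfl; exact M.not_hits_self _ h
        adj_dir := by
          intro u v h
          rw [hM] at h
          refine ⟨hN u v, fun h' => ?_⟩
          exact (M.hits_of_inter h.1.symm h.2).resolve_right h' }
    obtain ⟨σ, hσ⟩ := exists_sorted (fun v => co 0 (M.arc v).s)
    have mono : ∀ i j, i < j → co 0 (M.arc (σ i)).s < co 0 (M.arc (σ j)).s := by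
      intro i j h
      refine lt_of_le_of_ne (hσ h.le) ?_
      intro e
      exact M.s_ne (fun e => h.ne (σ.injective e)) (co_inj.1 e)
    refine ⟨D, σ, locallyStraight_of D σ ?_ ?_⟩
    · intro i j k hij hk
      apply M.hits_convex hP hij
      rw [sbtw_co 0]
      rcases hk with ⟨a, b⟩ | ⟨a, b⟩ | ⟨a, b⟩
      · exact Or.inl ⟨mono _ _ a, mono _ _ b⟩
      · exact Or.inr (Or.inl ⟨mono _ _ a, mono _ _ b⟩)
      · exact Or.inr (Or.inr ⟨mono _ _ a, mono _ _ b⟩)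
    · intro i j k a b c
      exact M.no_triangle hH hN a b c
  · push Not at hN
    obtain ⟨u, v, h1, h2⟩ := hN
    obtain ⟨r, hr2, hr⟩ := M.exists_rank hP hH h1 h2
    obtain ⟨σ, hσ⟩ := exists_sorted r
    let D : GraphOrientation G :=
      { dir := fun x y => G.Adj x y ∧ σ.symm x < σ.symm y
        dir_adj := fun _ _ h => h.1
        adj_dir := by
          intro x y h
          have : σ.symm x ≠ σ.symm y := fun e => h.ne (σ.symm.injective e)
          simp only [h, h.symm, true_and, not_lt]
          exact ⟨fun h => h.le, fun h => lt_of_le_of_ne h this⟩ }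
    refine ⟨D, σ, locallyStraight_of D σ ?_ ?_⟩
    · intro i j k hij hk
      obtain ⟨ha, hlt⟩ := hij
      simp only [Equiv.symm_apply_apply] at hlt
      have hk' : i < k ∧ k < j := by
        unfold SB at hk
        simp only [Fin.lt_def] at *
        omega
      have m1 : r (σ i) ≤ r (σ k) := hσ hk'.1.le
      have m2 : r (σ k) ≤ r (σ j) := hσ hk'.2.le
      have m3 := hr2 (σ j)
      rw [hM, hr] at ha
      refine ⟨⟨?_, by simpa using hk'.1⟩, ⟨?_, by simpa using hk'.2⟩⟩
      · rw [hM, hr]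
        exact ⟨fun e => hk'.1.ne (σ.injective e), by omega⟩
      · rw [hM, hr]
        exact ⟨fun e => hk'.2.ne (σ.injective e), by omega⟩
    · intro i j k a b c
      exact absurd (a.2.trans (b.2.trans c.2)) (lt_irrefl _)

/-! ### From a locally straight orientation to a proper Helly model -/

section Backward

variable {V : Type} [Fintype V] {G : SimpleGraph V}

theorem dir_irrefl (D : GraphOrientation G) (v : V) : ¬ D.dir v v :=
  fun h => (D.dir_adj _ _ h).ne rfl

theorem dir_asymm (D : GraphOrientation G) {u v : V} (h : D.dir u v) (h' : D.dir v u) : False :=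
  (D.adj_dir u v (D.dir_adj _ _ h)).1 h h'

theorem outDeg_lt (D : GraphOrientation G) (v : V) : D.outDeg v < Fintype.card V := by
  unfold GraphOrientation.outDeg
  rw [← Nat.card_eq_fintype_card, ← Set.ncard_univ]
  refine Set.ncard_lt_ncard ?_ (Set.toFinite _)
  refine lt_of_le_of_ne (Set.subset_univ _) ?_
  intro e
  have : v ∈ {w | D.dir v w} := by rw [e]; trivial
  exact dir_irrefl D v this

theorem dir_iff {D : GraphOrientation G} {σ : Fin (Fintype.card V) ≃ V} (h : IsRoundEnum D σ)
    (i j : Fin (Fintype.card V)) :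
    D.dir (σ i) (σ j) ↔ i ≠ j ∧ cdist (Fintype.card V) i j ≤ D.outDeg (σ i) := by
  have := (h i j).1
  constructor
  · intro hd
    refine ⟨?_, this.1 (Or.inr hd)⟩
    rintro rfl; exact dir_irrefl D _ hd
  · rintro ⟨hne, hc⟩
    exact (this.2 hc).resolve_left (fun e => hne (σ.injective e).symm)

theorem dir_iff' {D : GraphOrientation G} {σ : Fin (Fintype.card V) ≃ V} (h : IsRoundEnum D σ)
    (i j : Fin (Fintype.card V)) :
    D.dir (σ i) (σ j) ↔ i ≠ j ∧ cdist (Fintype.card V) i j ≤ D.inDeg (σ j) := by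
  have := (h j i).2
  constructor
  · intro hd
    refine ⟨?_, this.1 (Or.inr hd)⟩
    rintro rfl; exact dir_irrefl D _ hd
  · rintro ⟨hne, hc⟩
    exact (this.2 hc).resolve_left (fun e => hne (σ.injective e))

theorem outDeg_step {D : GraphOrientation G} {σ : Fin (Fintype.card V) ≃ V} (h : IsRoundEnum D σ)
    (j i : Fin (Fintype.card V)) :
    D.outDeg (σ j) ≤ cdist (Fintype.card V) j i + D.outDeg (σ i) := by
  by_contra hc
  obtain ⟨k, hk⟩ := cdist_surj j (outDeg_lt D (σ j))
  have hjk : j ≠ k := by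
    rintro rfl
    rw [cdist_self] at hk; omega
  have h1 : D.dir (σ j) (σ k) := (dir_iff h j k).2 ⟨hjk, hk.le⟩
  have h2 := ((dir_iff' h j k).1 h1).2
  have e : cdist (Fintype.card V) i k + cdist (Fintype.card V) j i = cdist (Fintype.card V) j k := by
    have := i.2
    have := j.2
    have := k.2
    have hlt : cdist (Fintype.card V) j i < cdist (Fintype.card V) j k := by omega
    clear hk hc h2
    simp only [cdist_eq] at *
    split_ifs at * <;> omega
  have hik : i ≠ k := by rintro rfl; omega
  have h3 : D.dir (σ i) (σ k) := (dir_iff' h i k).2 ⟨hik, by omega⟩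
  have := ((dir_iff h i k).1 h3).2
  omega

theorem no_dir_triangle {D : GraphOrientation G} {σ : Fin (Fintype.card V) ≃ V}
    (hs : IsLocallyStraightEnum D σ) (i j k : Fin (Fintype.card V))
    (hij : D.dir (σ i) (σ j)) (hjk : D.dir (σ j) (σ k)) (hki : D.dir (σ k) (σ i)) : False := by
  have h := hs.1
  obtain ⟨l, hl, hlmax⟩ := Set.exists_max_image {l | σ l = σ j ∨ D.dir (σ l) (σ j)}
    (fun l => cdist (Fintype.card V) l j) (Set.toFinite _) ⟨j, Or.inl rfl⟩
  obtain ⟨r, hr, hrmax⟩ := Set.exists_max_image {r | σ r = σ j ∨ D.dir (σ j) (σ r)}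
    (fun r => cdist (Fintype.card V) j r) (Set.toFinite _) ⟨j, Or.inl rfl⟩
  have H := hs.2 j l r ⟨hl, hlmax⟩ ⟨hr, hrmax⟩
  have m1 := hlmax i (Or.inr hij)
  have m2 := hrmax k (Or.inr hjk)
  have n1 : i ≠ j := ((dir_iff h i j).1 hij).1
  have n2 : j ≠ k := ((dir_iff h j k).1 hjk).1
  have hlj : l ≠ j := by
    rintro rfl
    rw [cdist_self] at m1
    exact n1 (cdist_inj' l (by rw [cdist_self]; omega))
  have hrj : r ≠ j := by
    rintro rfl
    rw [cdist_self] at m2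
    exact n2 (cdist_inj r (by rw [cdist_self]; omega))
  have dl : D.dir (σ l) (σ j) := hl.resolve_left (fun e => hlj (σ.injective e))
  have dr : D.dir (σ j) (σ r) := hr.resolve_left (fun e => hrj (σ.injective e))
  have hle : cdist (Fintype.card V) l j ≤ cdist (Fintype.card V) l r := by
    by_contra hc
    have a := ((dir_iff' h l j).1 dl).2
    have : D.dir (σ r) (σ j) := by
      refine (dir_iff' h r j).2 ⟨hrj, le_trans ?_ a⟩
      have := r.2
      have := j.2
      have := l.2
      clear m1 m2 a hlmax hrmax H
      simp only [cdist_eq] at *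
      split_ifs at * <;> omega
    exact dir_asymm D this dr
  have q1 : cdist (Fintype.card V) l i ≤ cdist (Fintype.card V) l j := by
    have := i.2
    have := j.2
    have := l.2
    clear m2 hlmax hrmax H hle
    simp only [cdist_eq] at *
    split_ifs at * <;> omega
  have q2 : cdist (Fintype.card V) l k ≤ cdist (Fintype.card V) l r := by
    have := k.2
    have := j.2
    have := l.2
    have := r.2
    clear m1 hlmax hrmax H q1
    simp only [cdist_eq] at *
    split_ifs at * <;> omega
  have e1 := ((H k i q2 (q1.trans hle)).1.1 (Or.inr hki)).1
  have e2 := ((H j k hle q2).1.1 (Or.inr hjk)).1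
  exact n2 (cdist_inj l (by omega))

/-- Auxiliary length function, in units of `1 / n`. -/
def fl (n d : ℕ) : ℝ := d + 1 / 2 - d * (1 / (4 * (n + 1)))

theorem fl_bounds {n d : ℕ} (h : d < n) : (d : ℝ) + 1 / 4 < fl n d ∧ fl n d ≤ d + 1 / 2 := by
  unfold fl
  have h1 : (d : ℝ) + 1 ≤ n := by exact_mod_cast h
  have hd : (0 : ℝ) ≤ d := Nat.cast_nonneg d
  have h2 : (d : ℝ) * (1 / (4 * (n + 1))) < 1 / 4 := by
    rw [mul_one_div, div_lt_iff₀ (by linarith)]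
    linarith
  have h3 : 0 ≤ (d : ℝ) * (1 / (4 * (n + 1))) := by positivity
  constructor <;> linarith

theorem fl_step {n d d' c : ℕ} (hc : 0 < c) (h : d ≤ c + d') : fl n d < c + fl n d' := by
  unfold fl
  have hδ : (0:ℝ) < 1 / (4 * (n + 1)) := by positivity
  have hδ1 : (1:ℝ) / (4 * (n + 1)) < 1 := by
    rw [div_lt_one (by positivity)]
    have : (0:ℝ) ≤ n := Nat.cast_nonneg n
    linarith
  have h1 : (d : ℝ) ≤ c + d' := by exact_mod_cast h
  have h2 : (0 : ℝ) < c := by exact_mod_cast hc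
  generalize (1:ℝ) / (4 * (n + 1)) = δ at *
  have h3 : 0 ≤ ((c:ℝ) + d' - d) * (1 - δ) := mul_nonneg (by linarith) (by linarith)
  have h4 : 0 < (c:ℝ) * δ := mul_pos h2 hδ
  nlinarith

theorem fract_div {n : ℕ} {x y : ℝ} (m : ℤ) (h0 : 0 ≤ y) (h1 : y < n) (e : x = y + m * n) :
    Int.fract (x / n) = y / n := by
  have hn : (0:ℝ) < n := by linarith
  have : x / n = y / n + m := by rw [e]; field_simp
  rw [this, Int.fract_add_intCast]
  refine Int.fract_eq_self.mpr ⟨by positivity, ?_⟩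
  rw [div_lt_one hn]; exact h1

theorem cdist_cast {n : ℕ} (i j : Fin n) :
    ∃ m : ℤ, ((j : ℕ) : ℝ) - ((i : ℕ) : ℝ) = cdist n i j + m * n := by
  have hi := i.2
  rw [cdist_eq]
  split_ifs with h
  · refine ⟨0, ?_⟩
    rw [Nat.cast_sub h]; simp
  · refine ⟨-1, ?_⟩
    rw [Nat.cast_sub (by omega)]; push_cast; ring

theorem circ_eq {x y : ℝ} (h : (x : Circ) = (y : Circ)) : ∃ m : ℤ, x - y = m := by
  have h' : ((x - y : ℝ) : Circ) = 0 := by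
    rw [AddCircle.coe_sub, h, sub_self]
  obtain ⟨m, hm⟩ := (AddCircle.coe_eq_zero_iff (1:ℝ)).1 h'
  exact ⟨m, by rw [← hm]; simp⟩

theorem fin_eq_of {n : ℕ} (i j : Fin n) (m : ℤ) (h : ((i:ℕ):ℤ) - ((j:ℕ):ℤ) = m * n) : i = j := by
  have hi := i.2
  have hj := j.2
  apply Fin.ext
  have hd : (n:ℤ) ∣ ((i:ℕ):ℤ) - ((j:ℕ):ℤ) := ⟨m, by rw [h]; ring⟩
  have := Int.eq_zero_of_abs_lt_dvd hd (by rw [abs_lt]; constructor <;> omega)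
  omega

theorem int_zero {z : ℤ} (h1 : -1 < (z:ℝ)) (h2 : (z:ℝ) < 1) : z = 0 := by
  have a : -1 < z := by exact_mod_cast h1
  have b : z < 1 := by exact_mod_cast h2
  omega

/-- The arcs of the model built from an enumeration. -/
def bArc (D : GraphOrientation G) (σ : Fin (Fintype.card V) ≃ V) (v : V) : Arc where
  s := ((((σ.symm v : ℕ) : ℝ) / (Fintype.card V : ℝ) : ℝ) : Circ)
  t := (((((σ.symm v : ℕ) : ℝ) + fl (Fintype.card V) (D.outDeg v)) / (Fintype.card V : ℝ) : ℝ) : Circ)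

theorem bArc_distinct (D : GraphOrientation G) (σ : Fin (Fintype.card V) ≃ V) :
    Function.Injective
      (fun p : V × Bool => if p.2 then (bArc D σ p.1).s else (bArc D σ p.1).t) := by
  have hn : ∀ v : V, (0:ℝ) < Fintype.card V := by
    intro v
    have : 0 < Fintype.card V := lt_of_le_of_lt (Nat.zero_le _) (outDeg_lt D v)
    exact_mod_cast this
  have ss : ∀ u v, (bArc D σ u).s = (bArc D σ v).s → u = v := by
    intro u v h
    obtain ⟨m, hm⟩ := circ_eq h
    have := hn u
    rw [← sub_div, div_eq_iff (by linarith)] at hm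
    have := fin_eq_of (σ.symm u) (σ.symm v) m (by exact_mod_cast hm)
    exact σ.symm.injective this
  have tt : ∀ u v, (bArc D σ u).t = (bArc D σ v).t → u = v := by
    intro u v h
    obtain ⟨m, hm⟩ := circ_eq h
    have := hn u
    rw [← sub_div, div_eq_iff (by linarith)] at hm
    have b1 := fl_bounds (outDeg_lt D u)
    have b2 := fl_bounds (outDeg_lt D v)
    have z : ((σ.symm u : ℕ) : ℤ) - ((σ.symm v : ℕ) : ℤ) + (D.outDeg u : ℤ) - (D.outDeg v : ℤ)
        - m * Fintype.card V = 0 := by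
      apply int_zero <;> push_cast <;> linarith [b1.1, b1.2, b2.1, b2.2]
    have z' : ((σ.symm u : ℕ) : ℝ) - ((σ.symm v : ℕ) : ℝ) + (D.outDeg u : ℝ) - (D.outDeg v : ℝ)
        - m * Fintype.card V = 0 := by exact_mod_cast z
    have hd : (D.outDeg u : ℝ) = D.outDeg v := by
      unfold fl at hm
      have hδ : (0:ℝ) < 1 / (4 * (Fintype.card V + 1)) := by positivity
      generalize (1:ℝ) / (4 * (Fintype.card V + 1)) = δ at *
      have : ((D.outDeg u : ℝ) - D.outDeg v) * δ = 0 := by linarith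
      rcases mul_eq_zero.1 this with h | h <;> linarith
    have hd' : D.outDeg u = D.outDeg v := by exact_mod_cast hd
    rw [hd'] at z
    exact σ.symm.injective (fin_eq_of (σ.symm u) (σ.symm v) m (by linarith))
  have ts : ∀ u v, (bArc D σ u).t ≠ (bArc D σ v).s := by
    intro u v h
    obtain ⟨m, hm⟩ := circ_eq h
    have := hn u
    rw [← sub_div, div_eq_iff (by linarith)] at hm
    have b1 := fl_bounds (outDeg_lt D u)
    have z : ((σ.symm u : ℕ) : ℤ) - ((σ.symm v : ℕ) : ℤ) + (D.outDeg u : ℤ)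
        - m * Fintype.card V = 0 := by
      apply int_zero <;> push_cast <;> linarith [b1.1, b1.2]
    have z' : ((σ.symm u : ℕ) : ℝ) - ((σ.symm v : ℕ) : ℝ) + (D.outDeg u : ℝ)
        - m * Fintype.card V = 0 := by exact_mod_cast z
    linarith [b1.1, b1.2]
  rintro ⟨u, a⟩ ⟨v, b⟩ h
  cases a <;> cases b
  · rw [tt u v (by simpa using h)]
  · exact absurd (by simpa using h) (ts u v)
  · exact absurd (by simpa using h.symm) (ts v u)
  · rw [ss u v (by simpa using h)]

/-- Membership in an arc. -/
theorem bArc_mem (D : GraphOrientation G) (σ : Fin (Fintype.card V) ≃ V)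
    (i : Fin (Fintype.card V)) (x y : ℝ) (m : ℤ) (h0 : 0 ≤ y) (h1 : y < Fintype.card V)
    (e : x - ((i:ℕ):ℝ) = y + m * Fintype.card V) :
    ((x / Fintype.card V : ℝ) : Circ) ∈ (bArc D σ (σ i)).pts ↔
      0 < y ∧ y < fl (Fintype.card V) (D.outDeg (σ i)) := by
  have hn : (0:ℝ) < Fintype.card V := by linarith
  have b := fl_bounds (outDeg_lt D (σ i))
  have hd : (D.outDeg (σ i) : ℝ) + 1 ≤ Fintype.card V := by exact_mod_cast outDeg_lt D (σ i)
  have hd0 : (0 : ℝ) ≤ D.outDeg (σ i) := Nat.cast_nonneg _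
  rw [mem_pts]
  unfold bArc
  simp only [Equiv.symm_apply_apply]
  rw [sbtw_coe_fract, ← sub_div, ← sub_div, fract_div m h0 h1 e,
    fract_div (y := fl (Fintype.card V) (D.outDeg (σ i))) 0 (by linarith) (by linarith)
      (by push_cast; ring), div_lt_div_iff_of_pos_right hn, div_pos_iff_of_pos_right hn]

theorem exists_sink {D : GraphOrientation G} (S : Set V)
    (hS : ∀ u ∈ S, ∀ v ∈ S, u ≠ v → D.dir u v ∨ D.dir v u)
    (ht : ∀ u v w, D.dir u v → D.dir v w → D.dir w u → False) (hne : S.Nonempty) :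
    ∃ k ∈ S, ∀ j ∈ S, j ≠ k → D.dir j k := by
  have hf : S.Finite := Set.toFinite S
  induction S, hf using Set.Finite.induction_on with
  | empty => exact absurd hne (by simp)
  | @insert a T haT hT ih =>
    rcases T.eq_empty_or_nonempty with rfl | hTn
    · refine ⟨a, by simp, ?_⟩
      intro j hj hja
      simp at hj; exact absurd hj hja
    obtain ⟨k, hk, hk'⟩ := ih (fun u hu v hv => hS u (Or.inr hu) v (Or.inr hv)) hTn
    have hak : a ≠ k := by rintro rfl; exact haT hk
    rcases hS a (Or.inl rfl) k (Or.inr hk) hak with h | h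
    · refine ⟨k, Or.inr hk, ?_⟩
      rintro j (rfl | hj) hjk
      · exact h
      · exact hk' j hj hjk
    · refine ⟨a, Or.inl rfl, ?_⟩
      rintro j (rfl | hj) hja
      · exact absurd rfl hja
      · by_cases hjk : j = k
        · rw [hjk]; exact h
        · refine (hS j (Or.inr hj) a (Or.inl rfl) hja).resolve_right ?_
          intro h'
          exact ht j k a (hk' j hj hjk) h h'

theorem backward (D : GraphOrientation G) (σ : Fin (Fintype.card V) ≃ V)
    (hs : IsLocallyStraightEnum D σ) : IsPHCAGraph G := by
  have h := hs.1
  let M : CAModel V := ⟨bArc D σ, bArc_distinct D σ⟩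
  have hitI : ∀ i j, M.Hits (σ i) (σ j) ↔ D.dir (σ i) (σ j) := by
    intro i j
    obtain ⟨m, hm⟩ := cdist_cast i j
    have hlt : (cdist (Fintype.card V) i j : ℝ) < Fintype.card V := by exact_mod_cast cdist_lt i j
    have e := bArc_mem D σ i ((j:ℕ):ℝ) _ m (Nat.cast_nonneg _) hlt hm
    have e' : M.Hits (σ i) (σ j) ↔
        (((((j:ℕ):ℝ) / Fintype.card V : ℝ)) : Circ) ∈ (bArc D σ (σ i)).pts := by
      rw [mem_pts]
      unfold CAModel.Hits
      have : (M.arc (σ j)).s = (((((j:ℕ):ℝ) / Fintype.card V : ℝ)) : Circ) := by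
        show (bArc D σ (σ j)).s = _
        unfold bArc; simp
      rw [this]
    rw [e', e, dir_iff h]
    have b := fl_bounds (outDeg_lt D (σ i))
    constructor
    · rintro ⟨a1, a2⟩
      constructor
      · rintro rfl
        rw [cdist_self] at a1; simp at a1
      · have : (cdist (Fintype.card V) i j : ℝ) < D.outDeg (σ i) + 1 := by linarith [b.2]
        have : cdist (Fintype.card V) i j < D.outDeg (σ i) + 1 := by exact_mod_cast this
        omega
    · rintro ⟨a1, a2⟩
      constructor
      · have : 0 < cdist (Fintype.card V) i j := by
          rcases Nat.eq_zero_or_pos (cdist (Fintype.card V) i j) with h | h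
          · exact absurd (cdist_inj i ((cdist_self i).trans h.symm)) a1
          · exact h
        exact_mod_cast this
      · have : (cdist (Fintype.card V) i j : ℝ) ≤ D.outDeg (σ i) := by exact_mod_cast a2
        linarith [b.1]
  have hit : ∀ u v, M.Hits u v ↔ D.dir u v := by
    intro u v
    have := hitI (σ.symm u) (σ.symm v)
    simpa using this
  have tri : ∀ u v w, D.dir u v → D.dir v w → D.dir w u → False := by
    intro u v w h1 h2 h3
    exact no_dir_triangle hs (σ.symm u) (σ.symm v) (σ.symm w)
      (by simpa using h1) (by simpa using h2) (by simpa using h3)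
  refine ⟨M, ?_, ?_, ?_⟩
  · intro u v huv hsub
    have hi : M.Inter u v := by
      obtain ⟨x, hx, -⟩ := M.inter_self u
      exact ⟨x, hx, hsub.1 hx⟩
    rcases M.hits_of_inter huv.symm hi with h1 | h1
    · exact M.not_hits_self v (mem_pts.1 (hsub.1 (mem_pts.2 h1)))
    · obtain ⟨i, rfl⟩ := σ.surjective u
      obtain ⟨j, rfl⟩ := σ.surjective v
      rw [hit] at h1
      obtain ⟨hne, hc⟩ := (dir_iff h j i).1 h1
      have hstep := outDeg_step h j i
      have hc0 : 0 < cdist (Fintype.card V) j i := by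
        rcases Nat.eq_zero_or_pos (cdist (Fintype.card V) j i) with h | h
        · exact absurd (cdist_inj j ((cdist_self j).trans h.symm)) hne
        · exact h
      have b := fl_bounds (outDeg_lt D (σ j))
      have f := fl_step (n := Fintype.card V) hc0 hstep
      obtain ⟨m, hm⟩ := cdist_cast j i
      have hc' : (cdist (Fintype.card V) j i : ℝ) ≤ D.outDeg (σ j) := by exact_mod_cast hc
      have hd : (D.outDeg (σ j) : ℝ) + 1 ≤ Fintype.card V := by exact_mod_cast outDeg_lt D (σ j)
      have hcc : (0 : ℝ) < cdist (Fintype.card V) j i := by exact_mod_cast hc0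
      have key := (bArc_mem D σ i (((j:ℕ):ℝ) + fl (Fintype.card V) (D.outDeg (σ j)))
        (fl (Fintype.card V) (D.outDeg (σ j)) - cdist (Fintype.card V) j i) (-m)
        (by linarith [b.1]) (by linarith [b.2]) (by push_cast; linarith)).2
        ⟨by linarith [b.1], by linarith⟩
      have e : (((((j:ℕ):ℝ) + fl (Fintype.card V) (D.outDeg (σ j))) / Fintype.card V : ℝ) : Circ)
          = (bArc D σ (σ j)).t := by
        unfold bArc; simp
      rw [e] at key
      have := mem_pts.1 (hsub.1 key)
      exact sbtw_irrefl_right this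
  · intro S hS
    rcases S.eq_empty_or_nonempty with rfl | hne
    · exact ⟨0, by simp⟩
    obtain ⟨k, hk, hk'⟩ := exists_sink (D := D) S (by
      intro u hu v hv huv
      have := M.hits_of_inter huv.symm (hS u hu v hv)
      rwa [hit, hit] at this) tri hne
    obtain ⟨k, rfl⟩ := σ.surjective k
    refine ⟨(((((k:ℕ):ℝ) + 1 / 4) / Fintype.card V : ℝ) : Circ), ?_⟩
    intro v hv
    obtain ⟨j, rfl⟩ := σ.surjective v
    have b := fl_bounds (outDeg_lt D (σ j))
    have hle : cdist (Fintype.card V) j k ≤ D.outDeg (σ j) := by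
      by_cases hjk : j = k
      · subst hjk; rw [cdist_self]; omega
      · exact ((dir_iff h j k).1 (hk' _ hv (fun e => hjk (σ.injective e)))).2
    have hle' : (cdist (Fintype.card V) j k : ℝ) ≤ D.outDeg (σ j) := by exact_mod_cast hle
    have hd : (D.outDeg (σ j) : ℝ) + 1 ≤ Fintype.card V := by exact_mod_cast outDeg_lt D (σ j)
    have h0 : (0:ℝ) ≤ cdist (Fintype.card V) j k := Nat.cast_nonneg _
    obtain ⟨m, hm⟩ := cdist_cast j k
    exact (bArc_mem D σ j (((k:ℕ):ℝ) + 1 / 4) (cdist (Fintype.card V) j k + 1 / 4) m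
      (by linarith) (by linarith) (by linarith)).2 ⟨by linarith, by linarith [b.1]⟩
  · intro u v
    constructor
    · intro ha
      refine ⟨ha.ne, ?_⟩
      by_cases hd : D.dir v u
      · exact M.inter_symm (M.inter_of_hits ((hit v u).2 hd))
      · exact M.inter_of_hits ((hit u v).2 ((D.adj_dir u v ha).2 hd))
    · rintro ⟨hne, hi⟩
      rcases M.hits_of_inter hne.symm hi with h1 | h1
      · exact D.dir_adj _ _ ((hit _ _).1 h1)
      · exact (D.dir_adj _ _ ((hit _ _).1 h1)).symm

end Backward

/-- A graph is a PHCA graph iff it admits a locally straight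
orientation. -/
theorem stmt_19 {V : Type} [Fintype V] (G : SimpleGraph V) :
    IsPHCAGraph G ↔
      ∃ (D : GraphOrientation G) (σ : Fin (Fintype.card V) ≃ V),
        IsLocallyStraightEnum D σ := by
  exact ⟨forward G, fun ⟨D, σ, h⟩ => backward D σ h⟩
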